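/- arXiv:2211.14600 — 2 statements merged into one kernel-verified Lean document; each statement's English description precedes it below -/
import Mathlib

section
/- Let C be a small coherent category and M : C ⥤ Type a coherent functor. The following are equivalent: (1) M is positively closed; (2) the equivalence relation ∼ on the set of pairs (u, a), where u is a subobject of an object x of C and a ∈ M x, defined by (u ≤ x, a) ∼ (v ≤ y, b) if and only if there is a subobject φ of x ⨯ y with (a, b) ∈ M φ and φ ⊓ π_x*(u) = φ ⊓ π_y*(v) (π_x*, π_y* denoting pullback of subobjects along the product projections), has exactly two equivalence classes; (3) for every object x of C and every a ∈ M x, the set {u ∈ Sub(x) : a ∈ M u} is a maximal proper filter of the lattice Sub(x); (4) for every coherent functor N : C ⥤ Type, every natural transformation M ⟶ N is elementary. -/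
open CategoryTheory CategoryTheory.Limits

universe w v u v' u'

namespace PosModel

variable {C : Type u} [Category.{v} C] {D : Type u'} [Category.{v'} D]

/-- A natural transformation is *elementary* if each naturality square at a
monomorphism is a pullback square. -/
def Elementary {N M : C ⥤ D} (η : N ⟶ M) : Prop :=
  ∀ ⦃a x : C⦄ (i : a ⟶ x), Mono i →
    IsPullback (N.map i) (η.app a) (η.app x) (M.map i)

/-- A functor preserves monomorphisms (formulated explicitly). -/
def PreservesMono (F : C ⥤ D) : Prop :=
  ∀ ⦃X Y : C⦄ (f : X ⟶ Y), Mono f → Mono (F.map f)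

/-- The subobject represented by a monomorphism (with an explicit proof of
monicity). -/
noncomputable def mkSub {X A : C} (f : A ⟶ X) (h : Mono f) : Subobject X :=
  haveI := h
  Subobject.mk f

/-- The image of a subobject under a mono-preserving functor. -/
noncomputable def mapSub (F : C ⥤ D) (h : PreservesMono F) {X : C} (a : Subobject X) :
    Subobject (F.obj X) :=
  mkSub (F.map a.arrow) (h a.arrow inferInstance)

/-- The subobject of a functor `M` represented by a pointwise-mono natural
transformation. -/
noncomputable def natSub {N M : C ⥤ D} (α : N ⟶ M) (h : ∀ x : C, Mono (α.app x)) :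
    Subobject M :=
  haveI : ∀ x : C, Mono (α.app x) := h
  haveI : Mono α := NatTrans.mono_of_mono_app α
  Subobject.mk α

/-- The axioms of a *coherent category*: a finitely complete category with
(pullback-stable) effective epi–mono factorizations, binary unions of
subobjects and a least subobject of every object, both stable under pullback. -/
structure CoherentData (C : Type u) [Category.{v} C] [HasFiniteLimits C] :
    Type (max u v) where
  sup : ∀ {X : C}, Subobject X → Subobject X → Subobject X
  le_sup_left : ∀ {X : C} (a b : Subobject X), a ≤ sup a b
  le_sup_right : ∀ {X : C} (a b : Subobject X), b ≤ sup a b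
  sup_le : ∀ {X : C} {a b c : Subobject X}, a ≤ c → b ≤ c → sup a b ≤ c
  bot : ∀ X : C, Subobject X
  bot_le : ∀ {X : C} (a : Subobject X), bot X ≤ a
  factor : ∀ {X Y : C} (f : X ⟶ Y), ∃ (Z : C) (e : X ⟶ Z) (m : Z ⟶ Y),
    EffectiveEpi e ∧ Mono m ∧ e ≫ m = f
  effectiveEpi_pullback : ∀ {P X Y Z : C} (fst : P ⟶ X) (snd : P ⟶ Y) (f : X ⟶ Z) (g : Y ⟶ Z),
    IsPullback fst snd f g → EffectiveEpi g → EffectiveEpi fst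
  sup_pullback : ∀ {X Y : C} (f : X ⟶ Y) (a b : Subobject Y),
    (Subobject.pullback f).obj (sup a b) =
      sup ((Subobject.pullback f).obj a) ((Subobject.pullback f).obj b)
  bot_pullback : ∀ {X Y : C} (f : X ⟶ Y),
    (Subobject.pullback f).obj (bot Y) = bot X

/-- The image of a subobject along an arbitrary morphism, computed using the
effective epi–mono factorizations of a coherent category. -/
noncomputable def CoherentData.img {C : Type u} [Category.{v} C] [HasFiniteLimits C]
    (hC : CoherentData C) {X Y : C} (f : X ⟶ Y) (a : Subobject X) : Subobject Y :=
  mkSub (hC.factor ((a.arrow : (a : C) ⟶ X) ≫ f)).choose_spec.choose_spec.choose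
    (hC.factor ((a.arrow : (a : C) ⟶ X) ≫ f)).choose_spec.choose_spec.choose_spec.2.1

/-- A functor between coherent categories is *coherent* if it preserves finite
limits, effective epimorphisms, finite unions of subobjects and the least
subobjects. -/
structure IsCoherent {C : Type u} [Category.{v} C] {D : Type u'} [Category.{v'} D]
    [HasFiniteLimits C] [HasFiniteLimits D]
    (hC : CoherentData C) (hD : CoherentData D) (F : C ⥤ D) : Prop where
  presLim : Nonempty (PreservesFiniteLimits F)
  presMono : PreservesMono F
  presEpi : ∀ ⦃X Y : C⦄ (f : X ⟶ Y), EffectiveEpi f → EffectiveEpi (F.map f)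
  map_sup : ∀ {X : C} (a b : Subobject X),
    mapSub F presMono (hC.sup a b) = hD.sup (mapSub F presMono a) (mapSub F presMono b)
  map_bot : ∀ X : C, mapSub F presMono (hC.bot X) = hD.bot (F.obj X)

/-- Two functors are *elementarily equivalent* if they validate the same
inclusions of subobjects. -/
def ElemEquiv [HasFiniteLimits C] [HasFiniteLimits D] (M N : C ⥤ D)
    (hM : PreservesMono M) (hN : PreservesMono N) : Prop :=
  ∀ (x : C) (a b : Subobject x),
    (mapSub M hM a ≤ mapSub M hM b) ↔ (mapSub N hN a ≤ mapSub N hN b)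

/-- Membership of an element in a subobject of a set. -/
def memSub {X : Type w} (S : Subobject X) (a : X) : Prop :=
  ∃ b : (S : Type w), S.arrow b = a

/-- A `Set`-valued coherent functor is *positively closed* if every element not
belonging to a subobject belongs to one disjoint from it. -/
def PositivelyClosed {C : Type u} [Category.{v} C] [HasFiniteLimits C]
    (hC : CoherentData C) (M : C ⥤ Type w) (hM : PreservesMono M) : Prop :=
  ∀ (x : C) (u : Subobject x) (a : M.obj x), ¬ memSub (mapSub M hM u) a →
    ∃ v : Subobject x, u ⊓ v = hC.bot x ∧ memSub (mapSub M hM v) a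

/-- The relation identifying `(u ≤ x, a ∈ M x)` and `(v ≤ y, b ∈ M y)` when
there is a subobject `φ` of `x ⨯ y` containing `(a, b)` with
`φ ⊓ π_x⁻¹ u = φ ⊓ π_y⁻¹ v`.  (Its quotient is the distributive lattice `L M`.) -/
def SimRel {C : Type u} [Category.{v} C] [HasFiniteLimits C]
    (M : C ⥤ Type w) (hM : PreservesMono M) :
    (Σ x : C, Subobject x × M.obj x) → (Σ y : C, Subobject y × M.obj y) → Prop :=
  fun p q =>
    ∃ (φ : Subobject (p.1 ⨯ q.1)) (c : M.obj (p.1 ⨯ q.1)),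
      M.map (prod.fst : p.1 ⨯ q.1 ⟶ p.1) c = p.2.2 ∧
      M.map (prod.snd : p.1 ⨯ q.1 ⟶ q.1) c = q.2.2 ∧
      memSub (mapSub M hM φ) c ∧
      φ ⊓ (Subobject.pullback (prod.fst : p.1 ⨯ q.1 ⟶ p.1)).obj p.2.1 =
        φ ⊓ (Subobject.pullback (prod.snd : p.1 ⨯ q.1 ⟶ q.1)).obj q.2.1

/-- A proper filter on the subobject lattice of `x` (a coherent category with
least subobjects given by `hC.bot`). -/
def IsProperFilter {C : Type u} [Category.{v} C] [HasFiniteLimits C]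
    (hC : CoherentData C) (x : C) (S : Set (Subobject x)) : Prop :=
  (⊤ : Subobject x) ∈ S ∧ hC.bot x ∉ S ∧
    (∀ ⦃u v : Subobject x⦄, u ∈ S → u ≤ v → v ∈ S) ∧
    (∀ ⦃u v : Subobject x⦄, u ∈ S → v ∈ S → u ⊓ v ∈ S)

section Subobjects

lemma le_iff_factors {X : C} {u v : Subobject X} :
    u ≤ v ↔ ∀ ⦃Y : C⦄ (f : Y ⟶ X), u.Factors f → v.Factors f :=
  ⟨fun h _ _ hf => Subobject.factors_of_le _ h hf,
    fun h => Subobject.le_of_factors (h _ u.factors_self)⟩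

lemma factors_of_strongEpi_comp {X Y Z : C} (e : X ⟶ Y) [StrongEpi e] (f : Y ⟶ Z)
    (u : Subobject Z) (h : u.Factors (e ≫ f)) : u.Factors f := by
  have sq : CommSq (u.factorThru (e ≫ f) h) e u.arrow f := ⟨by simp⟩
  rw [← sq.fac_right]
  exact Subobject.factors_comp_arrow _

variable [HasFiniteLimits C] (hC : CoherentData C)

/-- An object is inhabited if its least subobject is not the whole object. -/
def CoherentData.Inhabited (X : C) : Prop := hC.bot X ≠ ⊤

lemma bot_eq_top_of_hom {X Y : C} (f : Y ⟶ X) (h : hC.bot X = ⊤) : hC.bot Y = ⊤ := by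
  rw [← hC.bot_pullback f, h, Subobject.pullback_top]

lemma bot_eq_top_of_bot_factors {X Y : C} (f : Y ⟶ X) (h : (hC.bot X).Factors f) :
    hC.bot Y = ⊤ := by
  rw [← hC.bot_pullback f, eq_top_iff]
  refine Subobject.le_of_factors ((pullback_factors_iff _ _ _).2 ?_)
  exact Subobject.factors_of_factors_right _ h

lemma bot_factors_of_bot_eq_top {X Y : C} (f : Y ⟶ X) (h : hC.bot Y = ⊤) :
    (hC.bot X).Factors f := by
  rw [← Category.id_comp f, ← pullback_factors_iff, hC.bot_pullback, h]
  exact Subobject.top_factors _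

lemma inhabited_of_hom {X Y : C} (f : Y ⟶ X) (h : hC.Inhabited Y) : hC.Inhabited X :=
  fun hX => h (bot_eq_top_of_hom hC f hX)

/-- Every morphism `h : W ⟶ Z` factors through a subobject `χ` such that subobjects of `Z` which
agree after pullback along `h` agree on `χ`. -/
lemma exists_image (hC : CoherentData C) {W Z : C} (h : W ⟶ Z) : ∃ χ : Subobject Z, χ.Factors h ∧
    ∀ s t : Subobject Z, (Subobject.pullback h).obj s = (Subobject.pullback h).obj t →
      χ ⊓ s = χ ⊓ t := by
  obtain ⟨V, e, m, he, hm, rfl⟩ := hC.factor h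
  refine ⟨Subobject.mk m, (Subobject.mk_factors_iff _ _).2 ⟨e, rfl⟩, ?_⟩
  have key : ∀ s t : Subobject Z,
      (Subobject.pullback (e ≫ m)).obj s = (Subobject.pullback (e ≫ m)).obj t →
      Subobject.mk m ⊓ s ≤ Subobject.mk m ⊓ t := by
    intro s t hst
    rw [le_iff_factors]
    intro Y g hg
    rw [Subobject.inf_factors] at hg ⊢
    refine ⟨hg.1, ?_⟩
    obtain ⟨k, rfl⟩ : ∃ k : Y ⟶ V, k ≫ m = g := (Subobject.mk_factors_iff _ _).1 hg.1
    have := hC.effectiveEpi_pullback _ _ _ _ (IsPullback.of_hasPullback k e) he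
    apply factors_of_strongEpi_comp (pullback.fst k e)
    rw [pullback.condition_assoc, ← pullback_factors_iff, ← hst, pullback_factors_iff,
      ← pullback.condition_assoc]
    exact Subobject.factors_of_factors_right _ hg.2
  exact fun s t hst => le_antisymm (key s t hst) (key t s hst.symm)

/-- The pair of morphisms `e₁`, `e₂` with common target covers every inhabited object over it. -/
def CoherentData.Covers {x y₁ y₂ : C} (e₁ : y₁ ⟶ x) (e₂ : y₂ ⟶ x) : Prop :=
  ∀ ⦃X : C⦄ (f : X ⟶ x), hC.Inhabited X → ∃ (Y : C) (g : Y ⟶ X), hC.Inhabited Y ∧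
    ((∃ k, k ≫ e₁ = g ≫ f) ∨ ∃ k, k ≫ e₂ = g ≫ f)

lemma covers_of_effectiveEpi {x y : C} (e : y ⟶ x) (he : EffectiveEpi e) : hC.Covers e e := by
  intro X f hX
  refine ⟨pullback f e, pullback.fst f e, fun h => hX ?_,
    Or.inl ⟨pullback.snd f e, pullback.condition.symm⟩⟩
  have := hC.effectiveEpi_pullback _ _ _ _ (IsPullback.of_hasPullback f e) he
  have h2 : (hC.bot X).Factors (𝟙 X) := by
    apply factors_of_strongEpi_comp (pullback.fst f e)
    exact bot_factors_of_bot_eq_top hC _ h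
  exact bot_eq_top_of_bot_factors hC _ h2

lemma covers_of_sup {x : C} (u v : Subobject x) :
    hC.Covers (Subobject.ofLE u (hC.sup u v) (hC.le_sup_left u v))
      (Subobject.ofLE v (hC.sup u v) (hC.le_sup_right u v)) := by
  intro X f hX
  by_contra! hcon
  have aux : ∀ (w : Subobject x) (hw : w ≤ hC.sup u v),
      (∀ (Y : C) (g : Y ⟶ X), hC.Inhabited Y → ∀ k, k ≫ Subobject.ofLE w _ hw ≠ g ≫ f) →
      (Subobject.pullback (f ≫ (hC.sup u v).arrow)).obj w ≤ hC.bot X := by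
    intro w hw H
    apply Subobject.le_of_factors
    apply bot_factors_of_bot_eq_top
    by_contra hY
    have w1 := (Subobject.isPullback (f ≫ (hC.sup u v).arrow) w).w
    refine H _ (Subobject.arrow _) hY (Subobject.pullbackπ (f ≫ (hC.sup u v).arrow) w) ?_
    rw [← cancel_mono (hC.sup u v).arrow]
    simpa using w1
  refine hX (top_le_iff.1 ?_)
  have h1 : (Subobject.pullback (f ≫ (hC.sup u v).arrow)).obj (hC.sup u v) = ⊤ := by
    rw [← top_le_iff]
    refine Subobject.le_of_factors ((pullback_factors_iff _ _ _).2 ?_)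
    rw [← Category.assoc]
    exact Subobject.factors_comp_arrow _
  rw [← h1, hC.sup_pullback]
  exact hC.sup_le (aux u _ fun Y g hY => (hcon Y g hY).1) (aux v _ fun Y g hY => (hcon Y g hY).2)

end Subobjects


section TypeSubobjects

lemma memSub_mk {A X : Type w} (f : A ⟶ X) [Mono f] (a : X) :
    memSub (Subobject.mk f) a ↔ ∃ b, f b = a := by
  constructor
  · rintro ⟨b, rfl⟩
    refine ⟨(Subobject.underlyingIso f).hom b, ?_⟩
    rw [← ConcreteCategory.comp_apply, Subobject.underlyingIso_hom_comp_eq_mk]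
  · rintro ⟨b, rfl⟩
    refine ⟨(Subobject.underlyingIso f).inv b, ?_⟩
    rw [← ConcreteCategory.comp_apply, Subobject.underlyingIso_arrow]

lemma le_iff_memSub {X : Type w} {S T : Subobject X} :
    S ≤ T ↔ ∀ a, memSub S a → memSub T a := by
  constructor
  · rintro h _ ⟨b, rfl⟩
    refine ⟨Subobject.ofLE S T h b, ?_⟩
    rw [← ConcreteCategory.comp_apply, Subobject.ofLE_arrow]
  · intro h
    choose g hg using fun b => h (S.arrow b) ⟨b, rfl⟩
    refine Subobject.le_of_comm (TypeCat.ofHom g) ?_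
    ext b
    exact hg b

/-- The subobject of a type given by a set. -/
noncomputable def subobjectOfSet {X : Type w} (s : Set X) : Subobject X :=
  haveI : Mono (TypeCat.ofHom (Subtype.val : s → X)) :=
    (mono_iff_injective _).2 Subtype.val_injective
  Subobject.mk (TypeCat.ofHom (Subtype.val : s → X))

lemma memSub_subobjectOfSet {X : Type w} (s : Set X) (a : X) :
    memSub (subobjectOfSet s) a ↔ a ∈ s := by
  have : Mono (TypeCat.ofHom (Subtype.val : s → X)) :=
    (mono_iff_injective _).2 Subtype.val_injective
  exact (memSub_mk _ a).trans ⟨by rintro ⟨b, rfl⟩; exact b.2, fun h => ⟨⟨a, h⟩, rfl⟩⟩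

variable (hT : CoherentData (Type w))

lemma memSub_sup {X : Type w} (S T : Subobject X) (a : X) :
    memSub (hT.sup S T) a ↔ memSub S a ∨ memSub T a := by
  constructor
  · intro h
    have hle : hT.sup S T ≤ subobjectOfSet {a | memSub S a ∨ memSub T a} :=
      hT.sup_le (le_iff_memSub.2 fun b hb => (memSub_subobjectOfSet _ b).2 (Or.inl hb))
        (le_iff_memSub.2 fun b hb => (memSub_subobjectOfSet _ b).2 (Or.inr hb))
    exact (memSub_subobjectOfSet _ a).1 (le_iff_memSub.1 hle a h)
  · rintro (h | h)
    · exact le_iff_memSub.1 (hT.le_sup_left S T) a h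
    · exact le_iff_memSub.1 (hT.le_sup_right S T) a h

lemma not_memSub_bot {X : Type w} (a : X) : ¬ memSub (hT.bot X) a := fun h =>
  (memSub_subobjectOfSet ∅ a).1 (le_iff_memSub.1 (hT.bot_le _) a h)

lemma effectiveEpi_of_surjective {X Y : Type w} (f : X ⟶ Y) (hf : Function.Surjective f) :
    EffectiveEpi f where
  effectiveEpi := by
    have key : ∀ {W : Type w} (e : X ⟶ W),
        (∀ {Z : Type w} (g₁ g₂ : Z ⟶ X), g₁ ≫ f = g₂ ≫ f → g₁ ≫ e = g₂ ≫ e) →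
        ∀ x x', f x = f x' → e x = e x' := by
      intro W e h x x' hx
      have := h (TypeCat.ofHom fun _ : PUnit.{w + 1} => x) (TypeCat.ofHom fun _ => x')
        (by ext; exact hx)
      exact ConcreteCategory.congr_hom this PUnit.unit
    exact ⟨{
      desc := fun e _ => TypeCat.ofHom fun y => e (Function.surjInv hf y)
      fac := fun e h => by
        ext x
        exact key e h _ _ (Function.surjInv_eq hf _)
      uniq := fun e h m hm => by
        ext y
        change m y = e (Function.surjInv hf y)
        rw [← hm, ConcreteCategory.comp_apply, Function.surjInv_eq hf] }⟩

end TypeSubobjects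

section Membership

/-- The element `a` of `F.obj x` lies in the image under `F` of the subobject `u`. -/
def Mem (F : C ⥤ Type w) {x : C} (u : Subobject x) (a : F.obj x) : Prop :=
  ∃ b : F.obj (u : C), F.map u.arrow b = a

variable {F : C ⥤ Type w}

lemma memSub_mapSub_iff (hF : PreservesMono F) {x : C} (u : Subobject x) (a : F.obj x) :
    memSub (mapSub F hF u) a ↔ Mem F u a := by
  have := hF u.arrow inferInstance
  exact memSub_mk _ a

lemma mem_of_factors {x y : C} {u : Subobject x} {f : y ⟶ x} (h : u.Factors f) (a : F.obj y) :
    Mem F u (F.map f a) := by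
  refine ⟨F.map (u.factorThru f h) a, ?_⟩
  rw [← ConcreteCategory.comp_apply, ← F.map_comp, Subobject.factorThru_arrow]

lemma mem_of_le {x : C} {u v : Subobject x} (h : u ≤ v) {a : F.obj x} (ha : Mem F u a) :
    Mem F v a := by
  obtain ⟨b, rfl⟩ := ha
  exact mem_of_factors (Subobject.factors_of_le _ h u.factors_self) b

lemma mem_top {x : C} (a : F.obj x) : Mem F (⊤ : Subobject x) a := by
  have := mem_of_factors (F := F) (Subobject.top_factors (𝟙 x)) a
  simpa using this

lemma mem_of_map {N : C ⥤ Type w} (α : F ⟶ N) {x : C} {u : Subobject x} {a : F.obj x}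
    (h : Mem F u a) : Mem N u (α.app x a) := by
  obtain ⟨b, rfl⟩ := h
  exact ⟨α.app _ b, (NatTrans.naturality_apply α u.arrow b).symm⟩

lemma preservesMono_of_preservesFiniteLimits (F : C ⥤ D) [PreservesFiniteLimits F] :
    PreservesMono F :=
  fun _ _ _ _ => inferInstance

variable [HasFiniteLimits C]

lemma mem_pullback_iff [PreservesFiniteLimits F] {x y : C} (f : y ⟶ x) (u : Subobject x)
    (a : F.obj y) : Mem F ((Subobject.pullback f).obj u) a ↔ Mem F u (F.map f a) := by
  constructor
  · rintro ⟨b, rfl⟩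
    rw [← ConcreteCategory.comp_apply, ← F.map_comp]
    exact mem_of_factors ((pullback_factors_iff _ _ _).1 (Subobject.factors_self _)) b
  · rintro ⟨b, hb⟩
    obtain ⟨c, -, hc⟩ :=
      Types.exists_of_isPullback ((Subobject.isPullback f u).map F) b a hb
    exact ⟨c, hc⟩

lemma mem_inf [PreservesFiniteLimits F] {x : C} {u v : Subobject x} {a : F.obj x}
    (hu : Mem F u a) (hv : Mem F v a) : Mem F (u ⊓ v) a := by
  obtain ⟨b, rfl⟩ := hu
  obtain ⟨c, rfl⟩ := (mem_pullback_iff _ _ _).2 hv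
  rw [← ConcreteCategory.comp_apply, ← F.map_comp]
  refine mem_of_factors ((Subobject.inf_factors _).2 ⟨Subobject.factors_comp_arrow _, ?_⟩) c
  exact (pullback_factors_iff _ _ _).1 (Subobject.factors_self _)

variable (hC : CoherentData C)

/-- A functor is consistent if it sends objects which are not inhabited to empty types. -/
def CoherentData.Consistent (F : C ⥤ Type w) : Prop :=
  ∀ ⦃X : C⦄, F.obj X → hC.Inhabited X

variable {hC}

lemma CoherentData.Consistent.not_mem_bot (hF : hC.Consistent F) {x : C} (a : F.obj x) :
    ¬ Mem F (hC.bot x) a := fun ⟨b, _⟩ =>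
  hF b (bot_eq_top_of_bot_factors hC (hC.bot x).arrow (Subobject.factors_self _))

lemma consistent_of_isCoherent {hT : CoherentData (Type w)} (hF : IsCoherent hC hT F) :
    hC.Consistent F := by
  intro X a h
  apply not_memSub_bot hT a
  rw [← hF.map_bot, memSub_mapSub_iff, h]
  exact mem_top a

lemma isCoherent_of_covers (hT : CoherentData (Type w)) [PreservesFiniteLimits F]
    (hF : hC.Consistent F)
    (hcov : ∀ {x y₁ y₂ : C} (e₁ : y₁ ⟶ x) (e₂ : y₂ ⟶ x), hC.Covers e₁ e₂ → ∀ a : F.obj x,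
      (∃ b, F.map e₁ b = a) ∨ ∃ b, F.map e₂ b = a) : IsCoherent hC hT F where
  presLim := ⟨inferInstance⟩
  presMono := preservesMono_of_preservesFiniteLimits F
  presEpi x y f hf := effectiveEpi_of_surjective _ fun a => by
    simpa using hcov f f (covers_of_effectiveEpi hC f hf) a
  map_sup {x} u v := by
    apply le_antisymm
    · rw [le_iff_memSub]
      intro a ha
      rw [memSub_sup, memSub_mapSub_iff, memSub_mapSub_iff]
      rw [memSub_mapSub_iff] at ha
      obtain ⟨b, rfl⟩ := ha
      rcases hcov _ _ (covers_of_sup hC u v) b with ⟨c, rfl⟩ | ⟨c, rfl⟩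
      · refine Or.inl ⟨c, ?_⟩
        rw [← ConcreteCategory.comp_apply, ← F.map_comp, Subobject.ofLE_arrow]
      · refine Or.inr ⟨c, ?_⟩
        rw [← ConcreteCategory.comp_apply, ← F.map_comp, Subobject.ofLE_arrow]
    · apply hT.sup_le
      all_goals
        rw [le_iff_memSub]
        intro a ha
        rw [memSub_mapSub_iff] at ha ⊢
      · exact mem_of_le (hC.le_sup_left u v) ha
      · exact mem_of_le (hC.le_sup_right u v) ha
  map_bot x := by
    refine le_antisymm (le_iff_memSub.2 fun a ha => ?_) (hT.bot_le _)
    rw [memSub_mapSub_iff] at ha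
    exact (hF.not_mem_bot a ha).elim

end Membership


section ReducedProduct

lemma preservesFiniteLimits_of_isPullback [HasFiniteLimits C] {F : C ⥤ Type w}
    (hne : Nonempty (F.obj (⊤_ C))) (hsub : Subsingleton (F.obj (⊤_ C)))
    (ext : ∀ {P X Y Z : C} {fst : P ⟶ X} {snd : P ⟶ Y} {f : X ⟶ Z} {g : Y ⟶ Z},
      IsPullback fst snd f g → ∀ c d : F.obj P, F.map fst c = F.map fst d →
        F.map snd c = F.map snd d → c = d)
    (lift : ∀ {P X Y Z : C} {fst : P ⟶ X} {snd : P ⟶ Y} {f : X ⟶ Z} {g : Y ⟶ Z},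
      IsPullback fst snd f g → ∀ a b, F.map f a = F.map g b →
        ∃ c, F.map fst c = a ∧ F.map snd c = b) :
    PreservesFiniteLimits F := by
  have : PreservesLimitsOfShape WalkingCospan F :=
    preservesLimitsOfShape_walkingCospan_of_forall_isPullback fun X Y Z f g _ =>
      ⟨pullback f g, pullback.fst f g, pullback.snd f g, IsPullback.of_hasPullback f g,
        (Types.isPullback_iff _ _ _ _).2
          ⟨by rw [← F.map_comp, ← F.map_comp, pullback.condition],
            fun c d h => ext (IsPullback.of_hasPullback f g) c d h.1 h.2,
            lift (IsPullback.of_hasPullback f g)⟩⟩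
  have hu : Unique (F.obj (⊤_ C)) := ⟨⟨hne.some⟩, fun _ => Subsingleton.elim _ _⟩
  have : PreservesLimit (Functor.empty.{0} C) F :=
    preservesTerminal_of_iso F
      ((Types.isTerminalEquivUnique _).symm hu |>.uniqueUpToIso terminalIsTerminal)
  have : PreservesLimitsOfShape (Discrete.{0} PEmpty) F :=
    preservesLimitsOfShape_pempty_of_preservesTerminal F
  exact preservesFiniteLimits_of_preservesTerminal_and_pullbacks F

open Filter

variable {I : Type w} (l : Filter I) (Y : I → C)

/-- Families of morphisms `Y i ⟶ x` defined for almost all `i`. -/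
def PartialHom (x : C) : Type _ :=
  {y : ∀ i, Option (Y i ⟶ x) // ∀ᶠ i in l, ∃ f, y i = some f}

/-- Equality almost everywhere of partially defined families of morphisms. -/
instance PartialHom.setoid (x : C) : Setoid (PartialHom l Y x) where
  r y z := ∀ᶠ i in l, y.1 i = z.1 i
  iseqv :=
    { refl := fun _ => .of_forall fun _ => rfl
      symm := fun h => h.mono fun _ hi => hi.symm
      trans := fun h h' => (h.and h').mono fun _ hi => hi.1.trans hi.2 }

variable {l Y}

lemma PartialHom.exists_of_eventually {x : C} {P : ∀ i, (Y i ⟶ x) → Prop}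
    (h : ∀ᶠ i in l, ∃ f, P i f) :
    ∃ y : PartialHom l Y x, ∀ᶠ i in l, ∃ f, y.1 i = some f ∧ P i f := by
  classical
  have key : ∀ᶠ i in l, ∃ f, (fun i => if h : ∃ f, P i f then some h.choose else none) i = some f
      ∧ P i f := h.mono fun i hi => ⟨hi.choose, by simp [hi], hi.choose_spec⟩
  exact ⟨⟨_, key.mono fun i ⟨f, hf, _⟩ => ⟨f, hf⟩⟩, key⟩

/-- Composition of a partially defined family with a fixed morphism. -/
def PartialHom.comp {x z : C} (f : x ⟶ z) (y : PartialHom l Y x) : PartialHom l Y z :=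
  ⟨fun i => (y.1 i).map (· ≫ f), y.2.mono fun i ⟨g, hg⟩ => ⟨g ≫ f, by simp [hg]⟩⟩

lemma PartialHom.comp_apply {x z : C} (f : x ⟶ z) (y : PartialHom l Y x) (i : I) :
    (y.comp f).1 i = (y.1 i).map (· ≫ f) := rfl

variable (l Y)

/-- The reduced product along a filter of the functors corepresented by the objects `Y i`. -/
def reducedProduct : C ⥤ Type (max w v) where
  obj x := Quotient (PartialHom.setoid l Y x)
  map f := TypeCat.ofHom (Quotient.map (PartialHom.comp f) fun _ _ h =>
    Filter.Eventually.mono h fun i hi => by simp only [PartialHom.comp_apply, hi])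
  map_id x := by
    ext a
    induction a using Quotient.inductionOn with | _ y
    refine Quotient.sound (.of_forall fun i => ?_)
    simp [PartialHom.comp_apply]
  map_comp f g := by
    ext a
    induction a using Quotient.inductionOn with | _ y
    refine Quotient.sound (.of_forall fun i => ?_)
    simp [PartialHom.comp_apply, Function.comp_def]

variable {l Y}

/-- The class of a partially defined family of morphisms. -/
def PartialHom.toReducedProduct {x : C} (y : PartialHom l Y x) : (reducedProduct l Y).obj x :=
  Quotient.mk _ y

lemma reducedProduct_surj {x : C} (a : (reducedProduct l Y).obj x) :
    ∃ y : PartialHom l Y x, y.toReducedProduct = a := Quotient.exists_rep a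

lemma toReducedProduct_eq_iff {x : C} {y z : PartialHom l Y x} :
    y.toReducedProduct = z.toReducedProduct ↔ ∀ᶠ i in l, y.1 i = z.1 i := Quotient.eq

lemma reducedProduct_map {x z : C} (f : x ⟶ z) (y : PartialHom l Y x) :
    (reducedProduct l Y).map f y.toReducedProduct = (y.comp f).toReducedProduct := rfl

instance [HasFiniteLimits C] : PreservesFiniteLimits (reducedProduct l Y) := by
  apply preservesFiniteLimits_of_isPullback
  · obtain ⟨y, -⟩ := PartialHom.exists_of_eventually (l := l) (Y := Y) (x := ⊤_ C)
      (P := fun _ _ => True) (.of_forall fun i => ⟨terminal.from _, trivial⟩)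
    exact ⟨y.toReducedProduct⟩
  · refine ⟨fun a b => ?_⟩
    obtain ⟨y, rfl⟩ := reducedProduct_surj a
    obtain ⟨z, rfl⟩ := reducedProduct_surj b
    rw [toReducedProduct_eq_iff]
    filter_upwards [y.2, z.2]
    rintro i ⟨f, hf⟩ ⟨g, hg⟩
    rw [hf, hg, Subsingleton.elim f g]
  · intro P X Y Z fst snd f g h a b h₁ h₂
    obtain ⟨y, rfl⟩ := reducedProduct_surj a
    obtain ⟨z, rfl⟩ := reducedProduct_surj b
    rw [reducedProduct_map, reducedProduct_map, toReducedProduct_eq_iff] at h₁ h₂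
    rw [toReducedProduct_eq_iff]
    filter_upwards [y.2, z.2, h₁, h₂]
    rintro i ⟨c, hc⟩ ⟨d, hd⟩ h₁ h₂
    simp only [PartialHom.comp_apply, hc, hd, Option.map_some, Option.some.injEq] at h₁ h₂
    rw [hc, hd, h.hom_ext h₁ h₂]
  · intro P X Y Z fst snd f g h a b hab
    obtain ⟨y, rfl⟩ := reducedProduct_surj a
    obtain ⟨z, rfl⟩ := reducedProduct_surj b
    rw [reducedProduct_map, reducedProduct_map, toReducedProduct_eq_iff] at hab
    obtain ⟨c, hc⟩ := PartialHom.exists_of_eventually (l := l) (x := P)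
      (P := fun i k => some (k ≫ fst) = y.1 i ∧ some (k ≫ snd) = z.1 i) (by
        filter_upwards [y.2, z.2, hab]
        rintro i ⟨c, hc⟩ ⟨d, hd⟩ hab
        simp only [PartialHom.comp_apply, hc, hd, Option.map_some, Option.some.injEq] at hab
        exact ⟨h.lift c d hab, by simp [hc], by simp [hd]⟩)
    refine ⟨c.toReducedProduct, ?_, ?_⟩
    · rw [reducedProduct_map, toReducedProduct_eq_iff]
      filter_upwards [hc]
      rintro i ⟨k, hk, h₁, -⟩
      rw [← h₁, PartialHom.comp_apply, hk, Option.map_some]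
    · rw [reducedProduct_map, toReducedProduct_eq_iff]
      filter_upwards [hc]
      rintro i ⟨k, hk, -, h₂⟩
      rw [← h₂, PartialHom.comp_apply, hk, Option.map_some]

lemma reducedProduct_consistent [HasFiniteLimits C] (hC : CoherentData C) [l.NeBot]
    (hY : ∀ i, hC.Inhabited (Y i)) : hC.Consistent (reducedProduct l Y) := by
  intro X a
  obtain ⟨y, -⟩ := reducedProduct_surj a
  obtain ⟨i, f, -⟩ := y.2.exists
  exact inhabited_of_hom hC f (hY i)

end ReducedProduct

section Extension

variable {C : Type v} [SmallCategory C] [HasFiniteLimits C]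

lemma exists_directed_presentation (F : C ⥤ Type v) [PreservesFiniteLimits F] :
    ∃ (α : Type v) (_ : PartialOrder α) (_ : IsDirectedOrder α) (_ : Nonempty α)
      (X : α → C) (a : ∀ i, F.obj (X i)) (t : ∀ {i j : α}, i ≤ j → (X j ⟶ X i)),
      (∀ {i j k : α} (h : i ≤ j) (h' : j ≤ k), t h' ≫ t h = t (h.trans h')) ∧
      (∀ {i j : α} (h : i ≤ j), F.map (t h) (a j) = a i) ∧
      (∀ (z : C) (b : F.obj z), ∃ (i : α) (f : X i ⟶ z), F.map f (a i) = b) ∧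
      ∀ {z : C} {i : α} (f f' : X i ⟶ z), F.map f (a i) = F.map f' (a i) →
        ∃ (j : α) (h : i ≤ j), t h ≫ f = t h ≫ f' := by
  have := F.isCofiltered_elements
  obtain ⟨α, _, _, _, D, hD⟩ := IsFiltered.exists_directed (F.Elementsᵒᵖ)
  rw [Functor.final_iff_of_isFiltered] at hD
  refine ⟨α, inferInstance, inferInstance, inferInstance, fun i => (D.obj i).unop.1,
    fun i => (D.obj i).unop.2, fun h => (D.map (homOfLE h)).unop.val, ?_, ?_, ?_, ?_⟩
  · intro i j k h h'
    change (D.map (homOfLE h')).unop.val ≫ (D.map (homOfLE h)).unop.val =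
      (D.map (homOfLE h ≫ homOfLE h')).unop.val
    rw [D.map_comp, unop_comp, CategoryOfElements.comp_val]
  · intro i j h
    exact CategoryOfElements.map_snd _
  · intro z b
    obtain ⟨i, ⟨f⟩⟩ := hD.1 (Opposite.op ⟨z, b⟩)
    exact ⟨i, f.unop.val, CategoryOfElements.map_snd f.unop⟩
  · intro z i f f' h
    let m : (D.obj i).unop ⟶ (⟨z, F.map f (D.obj i).unop.2⟩ : F.Elements) :=
      CategoryOfElements.homMk _ _ f rfl
    let m' : (D.obj i).unop ⟶ (⟨z, F.map f (D.obj i).unop.2⟩ : F.Elements) :=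
      CategoryOfElements.homMk _ _ f' h.symm
    obtain ⟨j, s, hs⟩ := hD.2 m.op m'.op
    refine ⟨j, leOfHom s, ?_⟩
    have := congrArg (fun q => q.unop.val) hs
    exact this

/-- An element of a functor together with two morphisms into the object carrying it. -/
structure ElementCover (F : C ⥤ Type v) where
  {x : C}
  elt : F.obj x
  {y₁ : C}
  {y₂ : C}
  e₁ : y₁ ⟶ x
  e₂ : y₂ ⟶ x

open Filter in
/-- If every finite family of requirements, asking that an element lie in the image of one of two
morphisms, can be met over an inhabited object, then all of them are met in some consistent
finite limit preserving functor under `F`. -/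
lemma exists_consistent_extension (hC : CoherentData C) (F : C ⥤ Type v)
    [PreservesFiniteLimits F] {R : Type v} (c : R → ElementCover F)
    (H : ∀ (X : C) (a : F.obj X) (s : Finset R) (f : ∀ r ∈ s, X ⟶ (c r).x),
      (∀ r hr, F.map (f r hr) a = (c r).elt) → ∃ (Y : C) (g : Y ⟶ X), hC.Inhabited Y ∧
        ∀ r hr, (∃ k, k ≫ (c r).e₁ = g ≫ f r hr) ∨ ∃ k, k ≫ (c r).e₂ = g ≫ f r hr) :
    ∃ (G : C ⥤ Type v) (_ : PreservesFiniteLimits G) (η : F ⟶ G), hC.Consistent G ∧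
      ∀ r, (∃ b, G.map (c r).e₁ b = η.app _ (c r).elt) ∨
        ∃ b, G.map (c r).e₂ b = η.app _ (c r).elt := by
  classical
  obtain ⟨α, _, _, _, X, a, t, t_comp, ht, hsurj, heq⟩ := exists_directed_presentation F
  choose i₀ f₀ hf₀ using hsurj
  have H' : ∀ p : α × Finset R, ∃ (Y : C) (g : Y ⟶ X p.1), hC.Inhabited Y ∧
      ∀ r ∈ p.2, ∀ h : i₀ _ (c r).elt ≤ p.1,
        (∃ k, k ≫ (c r).e₁ = g ≫ t h ≫ f₀ _ _) ∨ ∃ k, k ≫ (c r).e₂ = g ≫ t h ≫ f₀ _ _ := by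
    intro p
    obtain ⟨Y, g, hY, hg⟩ := H (X p.1) (a p.1) (p.2.filter fun r => i₀ _ (c r).elt ≤ p.1)
      (fun r hr => t (Finset.mem_filter.1 hr).2 ≫ f₀ _ _) (fun r hr => by
        rw [F.map_comp, ConcreteCategory.comp_apply, ht, hf₀])
    exact ⟨Y, g, hY, fun r hr h => hg r (Finset.mem_filter.2 ⟨hr, h⟩)⟩
  choose Y g hY hg using H'
  have : (atTop : Filter (α × Finset R)).NeBot := by
    rw [← prod_atTop_atTop_eq]
    infer_instance
  let l : Ultrafilter (α × Finset R) := Ultrafilter.of atTop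
  have hle : ∀ p : α × Finset R, ∀ᶠ q in (l : Filter _), p ≤ q := fun p =>
    Ultrafilter.of_le _ (eventually_ge_atTop p)
  have ex : ∀ (z : C) (b : F.obj z), ∃ y : PartialHom (l : Filter _) Y z,
      ∀ᶠ p in (l : Filter _), ∃ k, y.1 p = some k ∧
        ∃ h : i₀ z b ≤ p.1, k = g p ≫ t h ≫ f₀ z b := fun z b =>
    PartialHom.exists_of_eventually ((hle (i₀ z b, ∅)).mono fun p hp => ⟨_, hp.1, rfl⟩)
  choose y hy using ex
  have key : ∀ {z : C} (b : F.obj z) (i : α) (f : X i ⟶ z), F.map f (a i) = b →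
      ∀ᶠ p in (l : Filter _), ∃ h : i ≤ p.1, (y z b).1 p = some (g p ≫ t h ≫ f) := by
    intro z b i f hf
    obtain ⟨j, hij, hj⟩ := exists_ge_ge i (i₀ z b)
    obtain ⟨k, hjk, hk⟩ := heq (t hij ≫ f) (t hj ≫ f₀ z b) (by
      rw [F.map_comp, ConcreteCategory.comp_apply, ht, hf, F.map_comp,
        ConcreteCategory.comp_apply, ht, hf₀])
    filter_upwards [hle (k, ∅), hy z b]
    rintro p ⟨hp, -⟩ ⟨_, hp', h, rfl⟩
    refine ⟨(hij.trans hjk).trans hp, ?_⟩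
    rw [hp', ← t_comp ((hij.trans hjk)) hp, ← t_comp hij hjk, Category.assoc, Category.assoc, hk,
      ← t_comp (hj.trans hjk) hp, ← t_comp hj hjk, Category.assoc, Category.assoc]
  let η : F ⟶ reducedProduct (l : Filter _) Y :=
    { app := fun z => TypeCat.ofHom fun b => (y z b).toReducedProduct
      naturality := fun z z' φ => by
        ext b
        change (y z' (F.map φ b)).toReducedProduct = ((y z b).comp φ).toReducedProduct
        rw [toReducedProduct_eq_iff]
        filter_upwards [key (F.map φ b) (i₀ z b) (f₀ z b ≫ φ) (by
          rw [F.map_comp, ConcreteCategory.comp_apply, hf₀]), hy z b]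
        rintro p ⟨h, hp⟩ ⟨_, hp', _, rfl⟩
        rw [hp, PartialHom.comp_apply, hp', Option.map_some]
        simp only [Category.assoc] }
  have hη : ∀ {z z' : C} (b : F.obj z) (e : z' ⟶ z),
      (∀ᶠ p in (l : Filter _), ∃ k, some (k ≫ e) = (y z b).1 p) →
      ∃ d, (reducedProduct (l : Filter _) Y).map e d = η.app z b := by
    intro z z' b e h
    obtain ⟨d, hd⟩ := PartialHom.exists_of_eventually h
    refine ⟨d.toReducedProduct, ?_⟩
    change (d.comp e).toReducedProduct = (y z b).toReducedProduct
    rw [toReducedProduct_eq_iff]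
    filter_upwards [hd]
    rintro p ⟨k, hk, hk'⟩
    rw [PartialHom.comp_apply, hk, ← hk', Option.map_some]
  refine ⟨reducedProduct (l : Filter _) Y, inferInstance, η,
    reducedProduct_consistent hC hY, fun r => ?_⟩
  have hr : ∀ᶠ p in (l : Filter _), (∃ k, some (k ≫ (c r).e₁) = (y _ (c r).elt).1 p) ∨
      ∃ k, some (k ≫ (c r).e₂) = (y _ (c r).elt).1 p := by
    filter_upwards [hle (i₀ _ (c r).elt, {r}), hy _ (c r).elt]
    rintro p ⟨-, hp⟩ ⟨_, hp', h, rfl⟩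
    rw [hp']
    exact (hg p r (hp (Finset.mem_singleton_self r)) h).imp
      (fun ⟨k, hk⟩ => ⟨k, congrArg some hk⟩) (fun ⟨k, hk⟩ => ⟨k, congrArg some hk⟩)
  exact (Ultrafilter.eventually_or.1 hr).imp (hη _ _) (hη _ _)

lemma exists_extension_witnessing_covers (hC : CoherentData C) (F : C ⥤ Type v)
    [PreservesFiniteLimits F] (hF : hC.Consistent F) :
    ∃ (G : C ⥤ Type v) (_ : PreservesFiniteLimits G) (η : F ⟶ G), hC.Consistent G ∧
      ∀ {x y₁ y₂ : C} (e₁ : y₁ ⟶ x) (e₂ : y₂ ⟶ x), hC.Covers e₁ e₂ → ∀ a : F.obj x,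
        (∃ b, G.map e₁ b = η.app x a) ∨ ∃ b, G.map e₂ b = η.app x a := by
  classical
  obtain ⟨G, hG, η, hGc, h⟩ := exists_consistent_extension hC F
    (R := {c : ElementCover F // hC.Covers c.e₁ c.e₂}) Subtype.val (by
      intro X a s f _
      induction s using Finset.induction_on with
      | empty => exact ⟨X, 𝟙 X, hF a, by simp⟩
      | insert r s hr ih =>
        obtain ⟨Y, g, hY, hg⟩ := ih (fun r' hr' => f r' (Finset.mem_insert_of_mem hr'))
          (fun r' hr' => by simp_all)
        obtain ⟨Z, k, hZ, hk⟩ := r.2 (g ≫ f r (Finset.mem_insert_self r s)) hY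
        refine ⟨Z, k ≫ g, hZ, fun r' hr' => ?_⟩
        rcases Finset.mem_insert.1 hr' with rfl | h
        · simpa using hk
        · simp only [Category.assoc]
          exact (hg r' h).imp (fun ⟨m, hm⟩ => ⟨k ≫ m, by rw [Category.assoc, hm]⟩)
            (fun ⟨m, hm⟩ => ⟨k ≫ m, by rw [Category.assoc, hm]⟩))
  exact ⟨G, hG, η, hGc, fun e₁ e₂ he a => h ⟨⟨a, e₁, e₂⟩, he⟩⟩

end Extension

section CoherentExtension

variable {C : Type v} [SmallCategory C] [HasFiniteLimits C]

lemma exists_coherent_extension (hC : CoherentData C) (hT : CoherentData (Type v))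
    (F : C ⥤ Type v) [hF : PreservesFiniteLimits F] (hFc : hC.Consistent F) :
    ∃ (N : C ⥤ Type v) (_ : IsCoherent hC hT N), Nonempty (F ⟶ N) := by
  have ext : ∀ G : {G : C ⥤ Type v // PreservesFiniteLimits G ∧ hC.Consistent G},
      ∃ (G' : {G : C ⥤ Type v // PreservesFiniteLimits G ∧ hC.Consistent G}) (η : G.1 ⟶ G'.1),
        ∀ {x y₁ y₂ : C} (e₁ : y₁ ⟶ x) (e₂ : y₂ ⟶ x), hC.Covers e₁ e₂ → ∀ a : G.1.obj x,
          (∃ b, G'.1.map e₁ b = η.app x a) ∨ ∃ b, G'.1.map e₂ b = η.app x a := by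
    rintro ⟨G, hG, hGc⟩
    obtain ⟨G', hG', η, hGc', h⟩ := exists_extension_witnessing_covers hC G hGc
    exact ⟨⟨G', hG', hGc'⟩, η, h⟩
  choose next η hη using ext
  let S : ℕ → {G : C ⥤ Type v // PreservesFiniteLimits G ∧ hC.Consistent G} :=
    fun n => next^[n] ⟨F, hF, hFc⟩
  have hS : ∀ n, S (n + 1) = next (S n) := fun n => Function.iterate_succ_apply' _ _ _
  let s : ∀ n, (S n).1 ⟶ (S (n + 1)).1 := fun n => η (S n) ≫ eqToHom (by rw [hS])
  have hs : ∀ (n : ℕ) {x y₁ y₂ : C} (e₁ : y₁ ⟶ x) (e₂ : y₂ ⟶ x), hC.Covers e₁ e₂ →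
      ∀ a : (S n).1.obj x, (∃ b, (S (n + 1)).1.map e₁ b = (s n).app x a) ∨
        ∃ b, (S (n + 1)).1.map e₂ b = (s n).app x a := by
    intro n x y₁ y₂ e₁ e₂ he a
    have aux : ∀ {G G' : C ⥤ Type v} (m : G ⟶ G') {x y : C} (e : y ⟶ x) (a : G.obj x),
        (∃ b, G.map e b = a) → ∃ b, G'.map e b = m.app x a := fun m _ _ e a ⟨b, hb⟩ =>
      ⟨m.app _ b, by rw [← hb, NatTrans.naturality_apply]⟩
    exact (hη (S n) e₁ e₂ he a).imp (aux (eqToHom (by rw [hS])) e₁ _)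
      (aux (eqToHom (by rw [hS])) e₂ _)
  let K : ℕ ⥤ C ⥤ Type v := Functor.ofSequence s
  have hK : ∀ n, PreservesFiniteLimits (K.obj n) := fun n => (S n).2.1
  let ι : ∀ n, K.obj n ⟶ K.flip ⋙ colim := fun n =>
    { app := fun x => colimit.ι (K.flip.obj x) n
      naturality := fun x y f => (colimit.ι_map (K.flip.map f) n).symm }
  have hι : ∀ (n : ℕ) {x : C} (a : (K.obj n).obj x),
      (ι (n + 1)).app x ((s n).app x a) = (ι n).app x a := by
    intro n x a
    have := ConcreteCategory.congr_hom
      (colimit.w (K.flip.obj x) (homOfLE (Nat.le_add_right n 1))) a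
    rw [Functor.flip_obj_map, Functor.ofSequence_map_homOfLE_succ] at this
    exact this
  have hsurj : ∀ {x : C} (a : (K.flip ⋙ colim).obj x), ∃ (n : ℕ) (b : (K.obj n).obj x),
      (ι n).app x b = a := fun a => Types.jointly_surjective' a
  have : PreservesFiniteLimits K.flip :=
    ⟨fun J _ _ => preservesLimitsOfShape_of_evaluation _ _ fun n => by
      have : PreservesLimitsOfShape J (K.obj n) := inferInstance
      exact this⟩
  refine ⟨K.flip ⋙ colim, isCoherent_of_covers hT (fun X a => ?_) fun e₁ e₂ he a => ?_, ⟨ι 0⟩⟩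
  · obtain ⟨n, b, -⟩ := hsurj a
    exact (S n).2.2 b
  · obtain ⟨n, b, rfl⟩ := hsurj a
    rw [← hι]
    exact (hs n e₁ e₂ he b).imp
      (fun ⟨d, hd⟩ => ⟨(ι (n + 1)).app _ d, by
        rw [← hd]; exact (NatTrans.naturality_apply (ι (n + 1)) e₁ d).symm⟩)
      (fun ⟨d, hd⟩ => ⟨(ι (n + 1)).app _ d, by
        rw [← hd]; exact (NatTrans.naturality_apply (ι (n + 1)) e₂ d).symm⟩)

end CoherentExtension

section SimRel

variable {C : Type u} [Category.{v} C] [HasFiniteLimits C] {M : C ⥤ Type w}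

lemma pullback_arrow_self {x : C} (u : Subobject x) : (Subobject.pullback u.arrow).obj u = ⊤ := by
  rw [← top_le_iff]
  refine Subobject.le_of_factors ((pullback_factors_iff _ _ _).2 ?_)
  exact Subobject.factors_comp_arrow _

lemma subsingleton_obj_terminal [PreservesFiniteLimits M] : Subsingleton (M.obj (⊤_ C)) :=
  (Types.isTerminalEquivUnique _ (terminalIsTerminal.isTerminalObj M)).instSubsingleton

lemma exists_disjoint_of_pullback_eq_bot (hC : CoherentData C) {x W : C} {u : Subobject x}
    {a : M.obj x} (f : W ⟶ x) (c : M.obj W) (hc : M.map f c = a)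
    (h : (Subobject.pullback f).obj u = hC.bot W) :
    ∃ v : Subobject x, u ⊓ v = hC.bot x ∧ Mem M v a := by
  subst hc
  obtain ⟨v, hv, hv'⟩ := exists_image hC f
  refine ⟨v, ?_, mem_of_factors hv c⟩
  rw [inf_comm, hv' u (hC.bot x) (by rw [h, hC.bot_pullback])]
  exact le_antisymm inf_le_right (hC.bot_le _)

lemma simRel_iff (hC : CoherentData C) (hM : PreservesMono M)
    {p q : Σ x : C, Subobject x × M.obj x} :
    SimRel M hM p q ↔ ∃ (W : C) (c : M.obj W) (f : W ⟶ p.1) (g : W ⟶ q.1),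
      M.map f c = p.2.2 ∧ M.map g c = q.2.2 ∧
        (Subobject.pullback f).obj p.2.1 = (Subobject.pullback g).obj q.2.1 := by
  constructor
  · rintro ⟨φ, c, h₁, h₂, hc, h⟩
    rw [memSub_mapSub_iff] at hc
    obtain ⟨d, rfl⟩ := hc
    refine ⟨φ, d, φ.arrow ≫ prod.fst, φ.arrow ≫ prod.snd, ?_, ?_, ?_⟩
    · rw [M.map_comp, ConcreteCategory.comp_apply, h₁]
    · rw [M.map_comp, ConcreteCategory.comp_apply, h₂]
    · have := congrArg (Subobject.pullback φ.arrow).obj h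
      simpa [Subobject.inf_pullback, Subobject.pullback_comp, pullback_arrow_self] using this
  · rintro ⟨W, c, f, g, hf, hg, h⟩
    obtain ⟨φ, hφ, hφ'⟩ := exists_image hC (prod.lift f g)
    refine ⟨φ, M.map (prod.lift f g) c, ?_, ?_, ?_, hφ' _ _ ?_⟩
    · rw [← ConcreteCategory.comp_apply, ← M.map_comp, prod.lift_fst, hf]
    · rw [← ConcreteCategory.comp_apply, ← M.map_comp, prod.lift_snd, hg]
    · exact (memSub_mapSub_iff hM _ _).2 (mem_of_factors hφ c)
    · rw [← Subobject.pullback_comp, ← Subobject.pullback_comp, prod.lift_fst, prod.lift_snd, h]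

lemma simRel_symm (hC : CoherentData C) (hM : PreservesMono M)
    {p q : Σ x : C, Subobject x × M.obj x} (h : SimRel M hM p q) : SimRel M hM q p := by
  rw [simRel_iff hC] at h ⊢
  obtain ⟨W, c, f, g, hf, hg, h⟩ := h
  exact ⟨W, c, g, f, hg, hf, h.symm⟩

lemma simRel_trans (hC : CoherentData C) (hM : PreservesMono M) [PreservesFiniteLimits M]
    {p q r : Σ x : C, Subobject x × M.obj x} (h : SimRel M hM p q) (h' : SimRel M hM q r) :
    SimRel M hM p r := by
  rw [simRel_iff hC] at h h' ⊢
  obtain ⟨W, c, f, g, hf, hg, h⟩ := h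
  obtain ⟨W', c', f', g', hf', hg', h'⟩ := h'
  obtain ⟨d, rfl, rfl⟩ := Types.exists_of_isPullback
    ((IsPullback.of_hasPullback g f').map M) c c' (hg.trans hf'.symm)
  refine ⟨_, d, pullback.fst g f' ≫ f, pullback.snd g f' ≫ g', ?_, ?_, ?_⟩
  · rw [M.map_comp, ConcreteCategory.comp_apply, hf]
  · rw [M.map_comp, ConcreteCategory.comp_apply, hg']
  · rw [Subobject.pullback_comp, h, ← Subobject.pullback_comp, pullback.condition,
      Subobject.pullback_comp, h', ← Subobject.pullback_comp]

lemma simRel_top_iff (hC : CoherentData C) (hM : PreservesMono M) [PreservesFiniteLimits M]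
    {x : C} {u : Subobject x} {a : M.obj x} {b : M.obj (⊤_ C)} :
    SimRel M hM ⟨x, u, a⟩ ⟨⊤_ C, ⊤, b⟩ ↔ Mem M u a := by
  rw [simRel_iff hC]
  constructor
  · rintro ⟨W, c, f, g, hf, -, h⟩
    replace hf : M.map f c = a := hf
    rw [← hf, ← mem_pullback_iff]
    refine mem_of_le (le_of_eq h.symm) ?_
    simpa [Subobject.pullback_top] using mem_top c
  · rintro ⟨c, rfl⟩
    refine ⟨u, c, u.arrow, terminal.from _, rfl, ?_, ?_⟩
    · exact subsingleton_obj_terminal.elim _ _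
    · exact (pullback_arrow_self u).trans (Subobject.pullback_top _).symm

lemma simRel_bot_iff (hC : CoherentData C) (hM : PreservesMono M) [PreservesFiniteLimits M]
    {x : C} {u : Subobject x} {a : M.obj x} {b : M.obj (⊤_ C)} :
    SimRel M hM ⟨x, u, a⟩ ⟨⊤_ C, hC.bot _, b⟩ ↔ ∃ v, u ⊓ v = hC.bot x ∧ Mem M v a := by
  rw [simRel_iff hC]
  constructor
  · rintro ⟨W, c, f, g, hf, -, h⟩
    exact exists_disjoint_of_pullback_eq_bot hC f c hf (by rw [h, hC.bot_pullback])
  · rintro ⟨v, h, c, rfl⟩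
    refine ⟨v, c, v.arrow, terminal.from _, rfl, ?_, ?_⟩
    · exact subsingleton_obj_terminal.elim _ _
    · have := congrArg (Subobject.pullback v.arrow).obj h
      simpa [Subobject.inf_pullback, pullback_arrow_self, hC.bot_pullback] using this

end SimRel

section Equivalences

lemma positivelyClosed_iff [HasFiniteLimits C] (hC : CoherentData C) {M : C ⥤ Type w}
    (hM : PreservesMono M) : PositivelyClosed hC M hM ↔
      ∀ (x : C) (u : Subobject x) (a : M.obj x), ¬ Mem M u a →
        ∃ v : Subobject x, u ⊓ v = hC.bot x ∧ Mem M v a := by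
  simp only [PositivelyClosed, memSub_mapSub_iff]

lemma positivelyClosed_iff_simRel [HasFiniteLimits C] (hC : CoherentData C)
    (hT : CoherentData (Type w)) {M : C ⥤ Type w} (hM : IsCoherent hC hT M) :
    PositivelyClosed hC M hM.presMono ↔
      ∃ p q : Σ x : C, Subobject x × M.obj x, ¬ SimRel M hM.presMono p q ∧
        ∀ r : Σ x : C, Subobject x × M.obj x,
          SimRel M hM.presMono r p ∨ SimRel M hM.presMono r q := by
  have := hM.presLim.some
  obtain ⟨b⟩ : Nonempty (M.obj (⊤_ C)) :=
    ⟨(terminalIsTerminal.isTerminalObj M).from PUnit .unit⟩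
  have hdis : ¬ SimRel M hM.presMono ⟨⊤_ C, ⊤, b⟩ ⟨⊤_ C, hC.bot _, b⟩ := by
    rw [simRel_bot_iff]
    rintro ⟨v, h, hb⟩
    rw [top_inf_eq] at h
    exact (consistent_of_isCoherent hM).not_mem_bot b (h ▸ hb)
  rw [positivelyClosed_iff]
  constructor
  · intro h
    refine ⟨_, _, hdis, ?_⟩
    rintro ⟨x, u, a⟩
    rw [simRel_top_iff hC, simRel_bot_iff]
    exact or_iff_not_imp_left.2 (h x u a)
  · rintro ⟨p, q, -, hpq⟩ x u a hu
    rw [← simRel_bot_iff hC hM.presMono (b := b)]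
    rw [← simRel_top_iff hC hM.presMono (b := b)] at hu
    have symm := fun {p q} => simRel_symm (p := p) (q := q) hC hM.presMono
    have trans := fun {p q r} => simRel_trans (p := p) (q := q) (r := r) hC hM.presMono
    rcases hpq ⟨x, u, a⟩ with h | h <;> rcases hpq ⟨⊤_ C, ⊤, b⟩ with h₁ | h₁ <;>
      rcases hpq ⟨⊤_ C, hC.bot _, b⟩ with h₂ | h₂
    all_goals first
      | exact trans h (symm h₂)
      | exact (hu (trans h (symm h₁))).elim
      | exact (hdis (trans h₁ (symm h₂))).elim

lemma positivelyClosed_iff_maximal [HasFiniteLimits C] (hC : CoherentData C)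
    (hT : CoherentData (Type w)) {M : C ⥤ Type w} (hM : IsCoherent hC hT M) :
    PositivelyClosed hC M hM.presMono ↔
      ∀ (x : C) (a : M.obj x),
        IsProperFilter hC x {u : Subobject x | memSub (mapSub M hM.presMono u) a} ∧
        ∀ T : Set (Subobject x), IsProperFilter hC x T →
          {u : Subobject x | memSub (mapSub M hM.presMono u) a} ⊆ T →
          T = {u : Subobject x | memSub (mapSub M hM.presMono u) a} := by
  have := hM.presLim.some
  rw [positivelyClosed_iff]
  simp only [memSub_mapSub_iff]
  constructor
  · intro h x a
    refine ⟨⟨mem_top a, (consistent_of_isCoherent hM).not_mem_bot a,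
      fun u v hu huv => mem_of_le huv hu, fun u v hu hv => mem_inf hu hv⟩, ?_⟩
    rintro T ⟨-, hT₁, -, hT₂⟩ hle
    refine hle.antisymm' fun u hu => by_contra fun hua => ?_
    obtain ⟨v, huv, hv⟩ := h x u a hua
    exact hT₁ (huv ▸ hT₂ hu (hle hv))
  · intro h x u a hu
    by_contra! hcon
    refine hu ?_
    have hT := (h x a).2 {w | ∃ t, Mem M t a ∧ t ⊓ u ≤ w} ⟨⟨⊤, mem_top a, le_top⟩, ?_, ?_, ?_⟩
      fun t ht => ⟨t, ht, inf_le_left⟩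
    · change u ∈ {u | Mem M u a}
      rw [← hT]
      exact ⟨⊤, mem_top a, inf_le_right⟩
    · rintro ⟨t, ht, hle⟩
      exact hcon t (inf_comm t u ▸ le_antisymm hle (hC.bot_le _)) ht
    · rintro v w ⟨t, ht, hle⟩ hvw
      exact ⟨t, ht, hle.trans hvw⟩
    · rintro v w ⟨t, ht, hle⟩ ⟨t', ht', hle'⟩
      exact ⟨t ⊓ t', mem_inf ht ht', le_inf ((inf_le_inf_right u inf_le_left).trans hle)
        ((inf_le_inf_right u inf_le_right).trans hle')⟩

lemma elementary_iff_mem [HasFiniteLimits C] {M N : C ⥤ Type w} [PreservesFiniteLimits M]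
    [PreservesFiniteLimits N] (α : M ⟶ N) : Elementary α ↔
      ∀ {x : C} (u : Subobject x) (a : M.obj x), Mem N u (α.app x a) → Mem M u a := by
  constructor
  · rintro h x u a ⟨b, hb⟩
    obtain ⟨c, hc, -⟩ := Types.exists_of_isPullback (h u.arrow inferInstance) a b hb.symm
    exact ⟨c, hc⟩
  · intro h y x i hi
    rw [Types.isPullback_iff]
    refine ⟨α.naturality i, fun c d hcd => ?_, fun a b hab => ?_⟩
    · exact (mono_iff_injective (M.map i)).1 inferInstance hcd.1
    · have hi' : (Subobject.mk i).Factors i := (Subobject.mk_factors_iff _ _).2 ⟨𝟙 _, by simp⟩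
      obtain ⟨c, rfl⟩ := h (Subobject.mk i) a (hab ▸ mem_of_factors hi' b)
      refine ⟨M.map (Subobject.underlyingIso i).hom c, ?_, ?_⟩
      · rw [← ConcreteCategory.comp_apply, ← M.map_comp, Subobject.underlyingIso_hom_comp_eq_mk]
      · apply (mono_iff_injective (N.map i)).1 inferInstance
        rw [← hab, ← NatTrans.naturality_apply, ← Subobject.underlyingIso_hom_comp_eq_mk,
          M.map_comp, ConcreteCategory.comp_apply]

lemma positivelyClosed_iff_elementary {C : Type v} [SmallCategory C] [HasFiniteLimits C]
    (hC : CoherentData C) (hT : CoherentData (Type v)) {M : C ⥤ Type v}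
    (hM : IsCoherent hC hT M) :
    PositivelyClosed hC M hM.presMono ↔
      ∀ (N : C ⥤ Type v) (_ : IsCoherent hC hT N) (α : M ⟶ N), Elementary α := by
  have := hM.presLim.some
  rw [positivelyClosed_iff]
  constructor
  · intro h N hN α
    have := hN.presLim.some
    rw [elementary_iff_mem]
    intro x u a hu
    by_contra hua
    obtain ⟨v, huv, hv⟩ := h x u a hua
    exact (consistent_of_isCoherent hN).not_mem_bot _ (huv ▸ mem_inf hu (mem_of_map α hv))
  · intro h x u a hu
    by_contra! hcon
    obtain ⟨G, _, η, hG, hGu⟩ := exists_consistent_extension hC M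
      (fun _ : PUnit.{v + 1} => ⟨a, u.arrow, u.arrow⟩) (by
        intro X b s f hf
        rcases s.eq_empty_or_nonempty with rfl | ⟨r, hr⟩
        · exact ⟨X, 𝟙 X, consistent_of_isCoherent hM b, by simp⟩
        · refine ⟨_, ((Subobject.pullback (f r hr)).obj u).arrow, fun hbot => ?_, fun r' _ =>
            Or.inl ⟨_, (Subobject.isPullback (f r hr) u).w⟩⟩
          obtain ⟨v, huv, hv⟩ := exists_disjoint_of_pullback_eq_bot hC (u := u) (f r hr) b
            (hf r hr) (le_antisymm (Subobject.le_of_factors (bot_factors_of_bot_eq_top hC _ hbot))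
              (hC.bot_le _))
          exact hcon v huv hv)
    obtain ⟨N, hN, ⟨α⟩⟩ := exists_coherent_extension hC hT G hG
    have := hN.presLim.some
    exact hu ((elementary_iff_mem _).1 (h N hN (η ≫ α)) u a
      (mem_of_map α (or_self_iff.1 (hGu PUnit.unit))))

end Equivalences

/-- For a coherent functor `M : C ⥤ Type` on a small coherent category the
following are equivalent: `M` is positively closed; the lattice `L M` (the
quotient of pairs `(u ≤ x, a ∈ M x)` by the relation `SimRel`) has exactly two
elements; every type realized in `M` is a maximal proper filter; every natural
transformation out of `M` to a coherent functor is elementary. -/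
theorem positivelyClosed_tfae (C : Type v) [SmallCategory C] [HasFiniteLimits C]
    (hC : CoherentData C) (hT : CoherentData (Type v))
    (M : C ⥤ Type v) (hM : IsCoherent hC hT M) :
    [ -- (1) `M` is positively closed
      PositivelyClosed hC M hM.presMono,
      -- (2) `SimRel` has exactly two equivalence classes
      (∃ p q : Σ x : C, Subobject x × M.obj x, ¬ SimRel M hM.presMono p q ∧
        ∀ r : Σ x : C, Subobject x × M.obj x,
          SimRel M hM.presMono r p ∨ SimRel M hM.presMono r q),
      -- (3) each realized type is a maximal proper filter
      (∀ (x : C) (a : M.obj x),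
        IsProperFilter hC x {u : Subobject x | memSub (mapSub M hM.presMono u) a} ∧
        ∀ T : Set (Subobject x), IsProperFilter hC x T →
          {u : Subobject x | memSub (mapSub M hM.presMono u) a} ⊆ T →
          T = {u : Subobject x | memSub (mapSub M hM.presMono u) a}),
      -- (4) every natural transformation out of `M` is elementary
      (∀ (N : C ⥤ Type v) (_ : IsCoherent hC hT N) (α : M ⟶ N), Elementary α)
    ].TFAE := by
  tfae_have 1 ↔ 2 := positivelyClosed_iff_simRel hC hT hM
  tfae_have 1 ↔ 3 := positivelyClosed_iff_maximal hC hT hM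
  tfae_have 1 ↔ 4 := positivelyClosed_iff_elementary hC hT hM
  tfae_finish

end PosModel
end

section
/- Let C be a small coherent category and let D be a coherent category whose subobject lattices admit joins of arbitrary small families over which binary meets distribute. If N : C ⥤ D is a positively closed coherent functor — meaning that for every subobject φ of every object x of C one has N x = N φ ⊔ ⨆ { N ψ : ψ ∈ Sub(x), ψ ⊓ φ = ⊥ } in Sub(N x) — then every natural transformation α : N ⟶ M to any coherent functor M : C ⥤ D is elementary. -/
open CategoryTheory CategoryTheory.Limits

universe w v u v' u'

namespace PosModel

variable {C : Type u} [Category.{v} C] {D : Type u'} [Category.{v'} D]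

/-- A morphism factors through the image under `F` of the subobject represented by `i`
exactly when it factors through `F.map i`. -/
theorem mapSub_mk_factors_iff {F : C ⥤ D} (h : PreservesMono F) {a x : C} (i : a ⟶ x) [Mono i]
    {W : D} (f : W ⟶ F.obj x) :
    (mapSub F h (Subobject.mk i)).Factors f ↔ ∃ g : W ⟶ F.obj a, g ≫ F.map i = f := by
  have := h (Subobject.mk i).arrow inferInstance
  rw [mapSub, mkSub, Subobject.mk_factors_iff]
  constructor
  · rintro ⟨(g : W ⟶ F.obj (Subobject.mk i : C)), hg⟩
    refine ⟨g ≫ F.map (Subobject.underlyingIso i).hom, ?_⟩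
    rw [Category.assoc, ← F.map_comp, Subobject.underlyingIso_hom_comp_eq_mk]
    exact hg
  · rintro ⟨g, rfl⟩
    refine ⟨g ≫ F.map (Subobject.underlyingIso i).inv, ?_⟩
    change (g ≫ F.map (Subobject.underlyingIso i).inv) ≫ F.map (Subobject.mk i).arrow = _
    rw [Category.assoc, ← F.map_comp, Subobject.underlyingIso_arrow]

theorem mapSub_factors_iff {F : C ⥤ D} (h : PreservesMono F) {x : C} (a : Subobject x)
    {W : D} (f : W ⟶ F.obj x) :
    (mapSub F h a).Factors f ↔ ∃ g : W ⟶ F.obj (a : C), g ≫ F.map a.arrow = f := by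
  conv_lhs => rw [← Subobject.mk_arrow a]
  exact mapSub_mk_factors_iff h a.arrow f

theorem mapSub_inf_factors [HasPullbacks C] {F : C ⥤ D} [PreservesLimitsOfShape WalkingCospan F]
    (h : PreservesMono F) {x : C} {a b : Subobject x} {W : D} {f : W ⟶ F.obj x}
    (ha : (mapSub F h a).Factors f) (hb : (mapSub F h b).Factors f) :
    (mapSub F h (a ⊓ b)).Factors f := by
  obtain ⟨g, hg⟩ := (mapSub_factors_iff h a f).1 ha
  obtain ⟨k, hk⟩ := (mapSub_factors_iff h b f).1 hb
  have sq := (Subobject.inf_isPullback a b).map F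
  refine (mapSub_factors_iff h (a ⊓ b) f).2 ⟨sq.lift g k (hg.trans hk.symm), ?_⟩
  rw [← Subobject.ofLE_arrow (inf_le_left : a ⊓ b ≤ a), F.map_comp, ← Category.assoc]
  exact (congrArg (· ≫ F.map a.arrow) (sq.lift_fst g k _)).trans hg

theorem mapSub_factors_app {N M : C ⥤ D} (hN : PreservesMono N) (hM : PreservesMono M)
    (α : N ⟶ M) {x : C} {a : Subobject x} {W : D} {f : W ⟶ N.obj x}
    (hf : (mapSub N hN a).Factors f) : (mapSub M hM a).Factors (f ≫ α.app x) := by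
  obtain ⟨g, rfl⟩ := (mapSub_factors_iff hN a f).1 hf
  exact (mapSub_factors_iff hM a _).2 ⟨g ≫ α.app _, by simp⟩

/-- A natural transformation is elementary as soon as the pullback of each `M φ` is
contained in `N φ`. -/
theorem elementary_of_pullback_mapSub_le [HasPullbacks D] {N M : C ⥤ D}
    (hN : PreservesMono N) (hM : PreservesMono M) (α : N ⟶ M)
    (hle : ∀ (x : C) (φ : Subobject x),
      (Subobject.pullback (α.app x)).obj (mapSub M hM φ) ≤ mapSub N hN φ) :
    Elementary α := by
  intro a x i hi
  have := hN i hi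
  have := hM i hi
  have key (s : PullbackCone (α.app x) (M.map i)) : ∃ g, g ≫ N.map i = s.fst :=
    (mapSub_mk_factors_iff hN i _).1 <| Subobject.factors_of_le _ (hle x (Subobject.mk i)) <|
      (Limits.pullback_factors_iff _ _ _).2 <|
        (mapSub_mk_factors_iff hM i _).2 ⟨s.snd, s.condition.symm⟩
  choose g hg using key
  refine ⟨⟨α.naturality i⟩, ⟨PullbackCone.IsLimit.mk _ g hg (fun s => ?_) fun s m hm _ => ?_⟩⟩
  · rw [← cancel_mono (M.map i), Category.assoc, ← α.naturality, ← Category.assoc, hg,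
      s.condition]
  · rw [← cancel_mono (N.map i), hm, hg]

/-- If `p ⊓ s` is least then `p ≤ r` whenever `r` and `s` cover. -/
theorem CoherentData.le_of_top_le_sup [HasFiniteLimits D] (hD : CoherentData D) {X : D}
    {p r s : Subobject X} (htop : ⊤ ≤ hD.sup r s) (hbot : p ⊓ s ≤ hD.bot X) : p ≤ r := by
  have hs : (Subobject.pullback p.arrow).obj s ≤ (Subobject.pullback p.arrow).obj r := by
    refine Subobject.le_of_factors ((Limits.pullback_factors_iff _ _ _).2 ?_)
    refine Subobject.factors_of_le _ (hbot.trans (hD.bot_le r)) ((Subobject.inf_factors _).2 ?_)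
    exact ⟨Subobject.factors_comp_arrow _,
      (Limits.pullback_factors_iff _ _ _).1 (Subobject.factors_self _)⟩
  have hr : ⊤ ≤ (Subobject.pullback p.arrow).obj r := by
    rw [← Subobject.pullback_top p.arrow]
    refine ((Subobject.pullback p.arrow).monotone htop).trans ?_
    rw [hD.sup_pullback]
    exact hD.sup_le le_rfl hs
  have h1 := Subobject.factors_of_le (𝟙 _) hr (Subobject.top_factors _)
  rw [Limits.pullback_factors_iff, Category.id_comp] at h1
  exact Subobject.le_of_factors h1

/-- Let `C` be a small coherent category and `D` a coherent category whose
subobject lattices have joins of arbitrary small families over which binary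
meets distribute.  If `N : C ⥤ D` is a positively closed coherent functor
(meaning `N x = N φ ⊔ ⨆ {N ψ : ψ ⊓ φ = ⊥}` in `Sub (N x)` for every subobject
`φ` of every `x`), then every natural transformation from `N` to a coherent
functor `M : C ⥤ D` is elementary. -/
theorem elementary_of_positivelyClosed (C : Type v) [SmallCategory C] [HasFiniteLimits C]
    {D : Type u} [Category.{v} D] [HasFiniteLimits D]
    (hC : CoherentData C) (hD : CoherentData D)
    -- joins of arbitrary small families of subobjects in `D` …
    (ssup : ∀ {X : D} {ι : Type v}, (ι → Subobject X) → Subobject X)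
    (le_ssup : ∀ {X : D} {ι : Type v} (f : ι → Subobject X) (i : ι), f i ≤ ssup f)
    (ssup_le : ∀ {X : D} {ι : Type v} (f : ι → Subobject X) (b : Subobject X),
      (∀ i, f i ≤ b) → ssup f ≤ b)
    -- … over which binary meets distribute
    (inf_ssup : ∀ {X : D} {ι : Type v} (a : Subobject X) (f : ι → Subobject X),
      a ⊓ ssup f = ssup fun i => a ⊓ f i)
    (N : C ⥤ D) (hN : IsCoherent hC hD N)
    -- `N` is positively closed
    (hclosed : ∀ (x : C) (φ : Subobject x),
      (⊤ : Subobject (N.obj x)) = hD.sup (mapSub N hN.presMono φ)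
        (ssup fun ψ : {ψ : Subobject x // ψ ⊓ φ = hC.bot x} =>
          mapSub N hN.presMono ψ.1))
    (M : C ⥤ D) (hM : IsCoherent hC hD M) (α : N ⟶ M) :
    Elementary α := by
  obtain ⟨_⟩ := hM.presLim
  refine elementary_of_pullback_mapSub_le hN.presMono hM.presMono α fun x φ => ?_
  refine hD.le_of_top_le_sup (hclosed x φ).le ?_
  rw [inf_ssup]
  refine ssup_le _ _ fun ⟨ψ, hψ⟩ => ?_
  dsimp only
  rw [← hD.bot_pullback (α.app x), ← hM.map_bot, ← hψ]
  refine Subobject.le_of_factors ((Limits.pullback_factors_iff _ _ _).2 ?_)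
  exact mapSub_inf_factors hM.presMono
    (mapSub_factors_app hN.presMono hM.presMono α (Subobject.inf_arrow_factors_right _ _))
    ((Limits.pullback_factors_iff _ _ _).1 (Subobject.inf_arrow_factors_left _ _))

end PosModel
end
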